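/- arXiv:1909.00092 — 3 statements merged into one kernel-verified Lean document; each statement's English description precedes it below -/
import Mathlib

section
/- Every real skew-symmetric n×n matrix A of rank r can be factored as A = Q M Qᵀ with Q orthogonal and M skew-symmetric and antitriangular; concretely, there exists orthogonal Q such that M = QᵀAQ satisfies M(i,j) = 0 for i + j ≤ n (1-indexed), and the antidiagonal entries M(k, n+1-k) are nonzero for exactly r values of k. -/
open Matrix ComplexOrder

/-- Orthonormal family putting a skew operator into antidiagonal form. -/
theorem skew_antidiag_aux (n : ℕ) : ∀ (E : Type) [NormedAddCommGroup E] [InnerProductSpace ℝ E]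
    [FiniteDimensional ℝ E] (T : E →ₗ[ℝ] E),
    (∀ x y, inner ℝ (T x) y = - inner ℝ x (T y)) → Module.finrank ℝ E = n →
    ∃ b : Fin n → E, Orthonormal ℝ b ∧
      ∀ i j : Fin n, (i : ℕ) + (j : ℕ) + 1 ≠ n → inner ℝ (b i) (T (b j)) = 0 := by
  induction n using Nat.strong_induction_on with
  | _ n ih =>
  intro E _ _ _ T hT hn
  have hself : ∀ x, inner ℝ x (T x) = 0 := by
    intro x
    have h := hT x x
    rw [real_inner_comm] at h
    linarith
  by_cases hT0 : T = 0
  · refine ⟨(stdOrthonormalBasis ℝ E).reindex (finCongr hn), OrthonormalBasis.orthonormal _, ?_⟩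
    intro i j _
    simp [hT0]
  have hS : (T ∘ₗ T).IsSymmetric := by
    intro x y
    simp only [LinearMap.comp_apply]
    rw [hT, hT, neg_neg]
  obtain ⟨i, hi⟩ : ∃ i, T (hS.eigenvectorBasis hn i) ≠ 0 := by
    by_contra! h
    apply hT0
    apply (hS.eigenvectorBasis hn).toBasis.ext
    intro i
    simpa using h i
  obtain ⟨v, μ, hv1, hTv, hTTv⟩ : ∃ (v : E) (μ : ℝ), ‖v‖ = 1 ∧ T v ≠ 0 ∧ T (T v) = μ • v :=
    ⟨_, hS.eigenvalues hn i, (hS.eigenvectorBasis hn).orthonormal.1 i, hi, by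
      exact hS.apply_eigenvectorBasis hn i⟩
  obtain ⟨w, c, d, hw1, hTvw, hTw⟩ :
      ∃ (w : E) (c d : ℝ), ‖w‖ = 1 ∧ T v = c • w ∧ T w = d • v := by
    have hne : ‖T v‖ ≠ 0 := norm_ne_zero_iff.mpr hTv
    refine ⟨‖T v‖⁻¹ • T v, ‖T v‖, ‖T v‖⁻¹ * μ, ?_, ?_, ?_⟩
    · rw [norm_smul, norm_inv, norm_norm, inv_mul_cancel₀ hne]
    · rw [smul_smul, mul_inv_cancel₀ hne, one_smul]
    · rw [map_smul, hTTv, smul_smul]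
  have hc : c ≠ 0 := by
    rintro rfl
    simp at hTvw
    exact hTv hTvw
  have hvw : inner ℝ v w = 0 := by
    have h := hself v
    rw [hTvw, inner_smul_right] at h
    exact (mul_eq_zero.mp h).resolve_left hc
  have hwv : inner ℝ w v = 0 := by rw [real_inner_comm]; exact hvw
  have hvv : inner ℝ v v = 1 := by rw [real_inner_self_eq_norm_sq, hv1]; norm_num
  have hww : inner ℝ w w = 1 := by rw [real_inner_self_eq_norm_sq, hw1]; norm_num
  have ho : Orthonormal ℝ ![v, w] := by
    rw [orthonormal_iff_ite]
    intro i j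
    fin_cases i <;> fin_cases j <;> simp [hvw, hwv, hv1, hw1]
  set P := Submodule.span ℝ (Set.range ![v, w]) with hP
  have hPd : Module.finrank ℝ P = 2 := by
    rw [hP, finrank_span_eq_card ho.linearIndependent]; simp
  have hsum := Submodule.finrank_add_finrank_orthogonal P
  obtain ⟨m, rfl⟩ : ∃ m, n = m + 2 := ⟨n - 2, by omega⟩
  have hWd : Module.finrank ℝ Pᗮ = m := by omega
  have hvP : v ∈ P := Submodule.subset_span ⟨0, rfl⟩
  have hwP : w ∈ P := Submodule.subset_span ⟨1, rfl⟩
  have hmem : ∀ x, inner ℝ v x = 0 → inner ℝ w x = 0 → x ∈ Pᗮ := by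
    intro x h1 h2
    rw [hP, Submodule.mem_orthogonal]
    intro u hu
    induction hu using Submodule.span_induction with
    | mem u h =>
      obtain ⟨k, rfl⟩ := h
      fin_cases k
      · exact h1
      · exact h2
    | zero => simp
    | add a b _ _ ha hb => rw [inner_add_left, ha, hb, add_zero]
    | smul a b _ hb => rw [inner_smul_left, hb, mul_zero]
  have hvx : ∀ x ∈ Pᗮ, inner ℝ v x = 0 := fun x hx => (Submodule.mem_orthogonal _ _).1 hx v hvP
  have hwx : ∀ x ∈ Pᗮ, inner ℝ w x = 0 := fun x hx => (Submodule.mem_orthogonal _ _).1 hx w hwP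
  have hinv : ∀ x ∈ Pᗮ, T x ∈ Pᗮ := by
    intro x hx
    apply hmem
    · have h := hT v x
      rw [hTvw, inner_smul_left, hwx x hx] at h
      simpa using h
    · have h := hT w x
      rw [hTw, inner_smul_left, hvx x hx] at h
      simpa using h
  obtain ⟨b, hb, hbT⟩ := ih m (by omega) Pᗮ (T.restrict hinv)
    (by intro x y; exact hT x y) hWd
  have hbv : ∀ i, inner ℝ v (b i : E) = 0 := fun i => hvx _ (b i).2
  have hbw : ∀ i, inner ℝ w (b i : E) = 0 := fun i => hwx _ (b i).2
  have hbv' : ∀ i, inner ℝ (b i : E) v = 0 := fun i => by rw [real_inner_comm]; exact hbv i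
  have hbw' : ∀ i, inner ℝ (b i : E) w = 0 := fun i => by rw [real_inner_comm]; exact hbw i
  have hTbv : ∀ i, inner ℝ v (T (b i : E)) = 0 := fun i => hvx _ (hinv _ (b i).2)
  have hTbw : ∀ i, inner ℝ w (T (b i : E)) = 0 := fun i => hwx _ (hinv _ (b i).2)
  have hbb : ∀ i j, inner ℝ (b i : E) (b j : E) = if i = j then (1 : ℝ) else 0 :=
    fun i j => orthonormal_iff_ite.1 hb i j
  have hbTb : ∀ i j : Fin m, (i : ℕ) + j + 1 ≠ m → inner ℝ (b i : E) (T (b j : E)) = 0 :=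
    fun i j h => hbT i j h
  let f : Fin (m + 2) → E :=
    Fin.cons v (Fin.snoc (α := fun _ => E) (fun i => (b i : E)) w : Fin (m + 1) → E)
  have f0 : f 0 = v := rfl
  have fl : f (Fin.last m).succ = w := by simp [f]
  have fm : ∀ i : Fin m, f i.castSucc.succ = (b i : E) := by intro i; simp [f]
  have hcases : ∀ i : Fin (m + 2), i = 0 ∨ i = (Fin.last m).succ ∨
      ∃ k : Fin m, i = k.castSucc.succ := by
    intro i
    refine Fin.cases (Or.inl rfl) (fun i => ?_) i
    exact Fin.lastCases (Or.inr (Or.inl rfl)) (fun k => Or.inr (Or.inr ⟨k, rfl⟩)) i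
  refine ⟨f, ?_, ?_⟩
  · rw [orthonormal_iff_ite]
    intro i j
    rcases hcases i with rfl | rfl | ⟨k, rfl⟩ <;> rcases hcases j with rfl | rfl | ⟨l, rfl⟩ <;>
      simp only [f0, fl, fm, hvv, hww, hvw, hwv, hbv, hbw, hbv', hbw', hbb] <;>
      simp [Fin.ext_iff] <;> omega
  · intro i j hij
    rcases hcases i with rfl | rfl | ⟨k, rfl⟩ <;> rcases hcases j with rfl | rfl | ⟨l, rfl⟩ <;>
      simp only [f0, fl, fm, hself, hTbv, hTbw]
    · exact absurd (by simp) hij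
    · exact absurd (by simp) hij
    · rw [hTvw, inner_smul_right, hbw', mul_zero]
    · rw [hTw, inner_smul_right, hbv', mul_zero]
    · apply hbTb
      simp at hij
      omega

theorem skew_symmetric_rank_antitriangular {n r : ℕ}
    (A : Matrix (Fin n) (Fin n) ℝ) (hA : Aᵀ = -A) (hr : A.rank = r) :
    ∃ Q : Matrix (Fin n) (Fin n) ℝ, Qᵀ * Q = 1 ∧
      (∀ i j : Fin n, (i : ℕ) + (j : ℕ) + 2 ≤ n → (Qᵀ * A * Q) i j = 0) ∧
      (Finset.univ.filter fun k : Fin n =>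
        (Qᵀ * A * Q) k ⟨n - 1 - (k : ℕ), by have := k.isLt; omega⟩ ≠ 0).card = r := by
  have hin : ∀ x y : EuclideanSpace ℝ (Fin n), inner ℝ x y = x.ofLp ⬝ᵥ y.ofLp := by
    intro x y
    simp [EuclideanSpace.inner_eq_star_dotProduct, dotProduct_comm]
  obtain ⟨b, hb, hbT⟩ := skew_antidiag_aux n (EuclideanSpace ℝ (Fin n)) (Matrix.toEuclideanLin A)
    (by
      intro x y
      rw [hin, hin]
      simp only [Matrix.ofLp_toLpLin, Matrix.toLin'_apply]
      rw [← Matrix.vecMul_transpose, hA, ← Matrix.dotProduct_mulVec, Matrix.neg_mulVec,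
        dotProduct_neg])
    (by simp)
  let Q : Matrix (Fin n) (Fin n) ℝ := Matrix.of fun i j => (b j).ofLp i
  have hQ : Qᵀ * Q = 1 := by
    ext i j
    have h := orthonormal_iff_ite.1 hb i j
    rw [hin] at h
    rw [Matrix.one_apply, ← h]
    rfl
  have hM : ∀ i j, (Qᵀ * A * Q) i j = inner ℝ (b i) (Matrix.toEuclideanLin A (b j)) := by
    intro i j
    rw [hin, Matrix.mul_assoc]
    rfl
  have hz : ∀ i j : Fin n, (i : ℕ) + j + 1 ≠ n → (Qᵀ * A * Q) i j = 0 := by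
    intro i j h
    rw [hM, hbT i j h]
  refine ⟨Q, hQ, fun i j h => hz i j (by omega), ?_⟩
  have hQu : IsUnit Q.det := by
    have := congrArg Matrix.det hQ
    rw [Matrix.det_mul, Matrix.det_one] at this
    exact IsUnit.of_mul_eq_one_right _ this
  have hQtu : IsUnit Qᵀ.det := by rwa [Matrix.det_transpose]
  have hrank : (Qᵀ * A * Q).rank = r := by
    rw [Matrix.rank_mul_eq_left_of_isUnit_det _ _ hQu,
      Matrix.rank_mul_eq_right_of_isUnit_det _ _ hQtu, hr]
  have hD : (Qᵀ * A * Q).submatrix (Equiv.refl _) Fin.revPerm =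
      Matrix.diagonal fun k : Fin n => (Qᵀ * A * Q) k (Fin.rev k) := by
    ext i j
    by_cases hij : i = j
    · subst hij
      simp
    · rw [Matrix.diagonal_apply_ne _ hij]
      apply hz
      simp [Fin.val_rev]
      intro h
      apply hij
      ext
      omega
  have h2 := Matrix.rank_submatrix (Qᵀ * A * Q) (Equiv.refl _) Fin.revPerm
  rw [hD, Matrix.rank_diagonal, hrank, Fintype.card_subtype] at h2
  rw [← h2]
  congr 1
  ext k
  have : (⟨n - 1 - (k : ℕ), by have := k.isLt; omega⟩ : Fin n) = Fin.rev k := by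
    ext
    simp [Fin.val_rev]
    omega
  simp only [Finset.mem_filter, this]
end

section
/- Let A ∈ ℂ^{n×n} be Hermitian and indefinite with inertia (n₋, n₀, n₊), n₁ = min(n₋, n₊), n₂ = max(n₋, n₊) - n₁. Then there exists a unitary Q such that M = Q*AQ has block form with blocks of sizes (n₀, n₁, n₂, n₁): M = [[0,0,0,0],[0,0,0,Y*],[0,0,X,Z*],[0,Y,Z,W]], where Y is nonsingular lower antitriangular, W is Hermitian, X is Hermitian definite, and Z arbitrary. -/
open Matrix ComplexOrder

lemma hba_cs (a b : ℝ) (h : a * b < 0) : ∃ c s : ℝ, c ^ 2 + s ^ 2 = 1 ∧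
    c ^ 2 * a + s ^ 2 * b = 0 ∧ c ≠ 0 ∧ s ≠ 0 := by
  have ha : a ≠ 0 := by rintro rfl; simp at h
  have hb : b ≠ 0 := by rintro rfl; simp at h
  have ha' : 0 < |a| := abs_pos.mpr ha
  have hb' : 0 < |b| := abs_pos.mpr hb
  refine ⟨√(|b| / (|a| + |b|)), √(|a| / (|a| + |b|)), ?_, ?_, ?_, ?_⟩
  · rw [Real.sq_sqrt (by positivity), Real.sq_sqrt (by positivity)]
    field_simp
    ring
  · rw [Real.sq_sqrt (by positivity), Real.sq_sqrt (by positivity)]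
    have : |b| * a + |a| * b = 0 := by
      rcases lt_or_gt_of_ne ha with h1 | h1
      · have h2 : 0 < b := by nlinarith
        rw [abs_of_neg h1, abs_of_pos h2]; ring
      · have h2 : b < 0 := by nlinarith
        rw [abs_of_neg h2, abs_of_pos h1]; ring
    field_simp
    linarith
  · positivity
  · positivity

/-- position class -/
def hbaCls (n z m : ℕ) (i : Fin n) : Fin 3 :=
  if (i : ℕ) < z then 0 else if (i : ℕ) < z + m then 1 else 2

lemma hba_perm {n z m : ℕ} (hzm : z + m ≤ n) (g : Fin n → Fin 3)
    (h0 : (Finset.univ.filter fun i => g i = 0).card = z)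
    (h1 : (Finset.univ.filter fun i => g i = 1).card = m) :
    ∃ f : Fin n ≃ Fin n, ∀ i, g (f i) = hbaCls n z m i := by
  have key : ∀ h : Fin n → Fin 3, (Finset.univ.filter fun i => h i = 0).card +
      (Finset.univ.filter fun i => h i = 1).card +
      (Finset.univ.filter fun i => h i = 2).card = n := by
    intro h
    have := Finset.card_eq_sum_card_fiberwise (f := h) (s := Finset.univ) (t := Finset.univ)
      (fun _ _ => by simp)
    simp [Fin.sum_univ_three] at this
    omega
  have c0 : (Finset.univ.filter fun i => hbaCls n z m i = 0).card = z := by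
    have : (Finset.univ.filter fun i => hbaCls n z m i = 0)
        = Finset.univ.filter fun i : Fin n => (i : ℕ) < z := by
      ext i; simp only [Finset.mem_filter, Finset.mem_univ, true_and]
      unfold hbaCls
      split_ifs <;> simp_all
    rw [this, Fin.card_filter_val_lt]; omega
  have c01 : (Finset.univ.filter fun i => hbaCls n z m i = 0).card +
      (Finset.univ.filter fun i => hbaCls n z m i = 1).card = z + m := by
    rw [← Finset.card_union_of_disjoint]
    · have : (Finset.univ.filter fun i => hbaCls n z m i = 0) ∪
          (Finset.univ.filter fun i => hbaCls n z m i = 1)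
          = Finset.univ.filter fun i : Fin n => (i : ℕ) < z + m := by
        ext i; simp only [Finset.mem_filter, Finset.mem_univ, true_and, Finset.mem_union]
        unfold hbaCls
        split_ifs <;> simp <;> omega
      rw [this, Fin.card_filter_val_lt]; omega
    · rw [Finset.disjoint_filter]; intro i _ h; rw [h]; decide
  have e : ∀ c, Nonempty ({a // hbaCls n z m a = c} ≃ {b // g b = c}) := by
    intro c
    refine ⟨Fintype.equivOfCardEq ?_⟩
    rw [Fintype.card_subtype, Fintype.card_subtype]
    have k1 := key g
    have k2 := key (hbaCls n z m)
    fin_cases c <;> simp <;> omega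
  refine ⟨Equiv.ofFiberEquiv (fun c => (e c).some), fun i => ?_⟩
  exact Equiv.ofFiberEquiv_map _ i

/-- partner index -/
def hbaP (n z m : ℕ) (i : Fin n) : Fin n :=
  if h : z ≤ (i : ℕ) ∧ ((i : ℕ) < z + m ∨ n - m ≤ (i : ℕ)) then
    ⟨n - 1 + z - i, by omega⟩ else i

lemma hbaP_invol {n z m : ℕ} (hzm : z + m + m ≤ n) (i : Fin n) :
    hbaP n z m (hbaP n z m i) = i := by
  ext
  by_cases h : z ≤ (i : ℕ) ∧ ((i : ℕ) < z + m ∨ n - m ≤ (i : ℕ))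
  · have : z ≤ n - 1 + z - (i : ℕ) ∧ (n - 1 + z - (i : ℕ) < z + m ∨ n - m ≤ n - 1 + z - (i : ℕ)) := by
      omega
    simp only [hbaP, dif_pos h, dif_pos this]
    omega
  · simp only [hbaP, dif_neg h]

lemma hba_comb {n : ℕ} (f : Fin n ≃ Fin n) (p : Fin n → Fin n) (hp : ∀ i, p (p i) = i)
    (c s : Fin n → ℝ) (d : Fin n → ℝ) (P : Matrix (Fin n) (Fin n) ℂ)
    (hP : P = Matrix.of fun k j => (if k = f j then (c j : ℂ) else 0)
      + (if k = f (p j) then (s j : ℂ) else 0)) (i j : Fin n) :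
    (Pᴴ * Matrix.diagonal (fun k => (d k : ℂ)) * P) i j =
      (if i = j then ((c i ^ 2 * d (f i) + s i ^ 2 * d (f (p i)) : ℝ) : ℂ) else 0) +
      (if i = p j then
        ((c i * s (p i) * d (f i) + s i * c (p i) * d (f (p i)) : ℝ) : ℂ) else 0) := by
  have hpi : ∀ a b, p a = b ↔ a = p b := fun a b =>
    ⟨fun h => by rw [← h, hp], fun h => by rw [h, hp]⟩
  have hinj : ∀ a b, p a = p b ↔ a = b := fun a b => by rw [hpi, hp]
  rw [Matrix.mul_apply]
  simp only [Matrix.mul_diagonal, Matrix.conjTranspose_apply, hP, Matrix.of_apply, star_add,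
    apply_ite (star : ℂ → ℂ), star_zero, Complex.star_def, Complex.conj_ofReal, mul_add, add_mul,
    ite_mul, mul_ite, zero_mul, mul_zero, Finset.sum_add_distrib, Finset.sum_ite_eq',
    Finset.mem_univ, if_true, EmbeddingLike.apply_eq_iff_eq]
  by_cases h1 : i = j
  · subst h1
    by_cases h2 : i = p i
    · simp only [← h2, if_true]; push_cast; ring
    · have h3 : ¬ (p i = i) := fun h => h2 h.symm
      simp only [h2, h3, if_true, if_false]; push_cast; ring
  · have h1' : ¬ (j = i) := fun h => h1 h.symm
    have h4 : ¬ (p j = p i) := by rwa [hinj]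
    have h5 : ¬ (p i = p j) := by rwa [hinj]
    by_cases h2 : i = p j
    · have h3 : p i = j := by rw [h2, hp]
      subst h3
      simp only [hp, h1, h1', if_true, if_false]; push_cast; ring
    · have h3 : ¬ (p i = j) := by rwa [hpi]
      have h6 : ¬ (p j = i) := fun h => h2 h.symm
      have h7 : ¬ (j = p i) := fun h => h3 h.symm
      simp only [h1, h1', h2, h3, h4, h5, h6, h7, if_false]; ring

lemma hba_main {n z m : ℕ} (hzm : z + m + m ≤ n) (ε : ℝ) (hε : ε ^ 2 = 1)
    (A : Matrix (Fin n) (Fin n) ℂ) (hA : A.IsHermitian)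
    (hz : (Finset.univ.filter fun i => hA.eigenvalues i = 0).card = z)
    (hm : (Finset.univ.filter fun i => ε * hA.eigenvalues i < 0).card = m) :
    ∃ (Q : Matrix (Fin n) (Fin n) ℂ) (d y : Fin n → ℝ), Qᴴ * Q = 1 ∧
      (∀ i j, (Qᴴ * A * Q) i j = (if i = j then (d i : ℂ) else 0) +
        (if i = hbaP n z m j then (y i : ℂ) else 0)) ∧
      (∀ i : Fin n, (i : ℕ) < z + m → d i = 0) ∧
      (∀ i : Fin n, z + m ≤ (i : ℕ) → (i : ℕ) < n - m → 0 < ε * d i) ∧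
      (∀ i : Fin n, (i : ℕ) < z → y i = 0) ∧
      (∀ i : Fin n, z + m ≤ (i : ℕ) → (i : ℕ) < n - m → y i = 0) ∧
      (∀ i : Fin n, n - m ≤ (i : ℕ) → y i ≠ 0) := by
  classical
  have hε0 : ε ≠ 0 := by rintro rfl; norm_num at hε
  obtain ⟨f, hf⟩ := hba_perm (z := z) (m := m) (by omega)
    (fun i => if hA.eigenvalues i = 0 then (0 : Fin 3)
      else if ε * hA.eigenvalues i < 0 then 1 else 2)
    (by
      rw [← hz]; congr 1; ext i
      simp only [Finset.mem_filter, Finset.mem_univ, true_and]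
      split_ifs <;> simp_all)
    (by
      rw [← hm]; congr 1; ext i
      simp only [Finset.mem_filter, Finset.mem_univ, true_and]
      split_ifs with h1 h2
      · simp [h1]
      · simp [h2]
      · simp [h2])
  set μ : Fin n → ℝ := fun i => hA.eigenvalues (f i) with hμ
  have f0 : ∀ i : Fin n, (i : ℕ) < z → μ i = 0 := by
    intro i hi
    have := hf i
    simp only [hbaCls, if_pos hi] at this
    by_contra hne
    simp only [hμ] at hne
    rw [if_neg hne] at this
    split_ifs at this <;> simp at this
  have f1 : ∀ i : Fin n, z ≤ (i : ℕ) → (i : ℕ) < z + m → ε * μ i < 0 := by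
    intro i hi hi2
    have := hf i
    simp only [hbaCls, if_neg (not_lt.mpr hi), if_pos hi2] at this
    split_ifs at this with h1 h2
    · simp at this
    · exact h2
    · simp at this
  have f2 : ∀ i : Fin n, z + m ≤ (i : ℕ) → 0 < ε * μ i := by
    intro i hi
    have := hf i
    simp only [hbaCls, if_neg (not_lt.mpr hi), if_neg (show ¬ ((i : ℕ) < z) by omega)] at this
    split_ifs at this with h1 h2
    · simp at this
    · simp at this
    · exact lt_of_le_of_ne (not_lt.mp h2) (Ne.symm (mul_ne_zero hε0 h1))
  have hcs : ∀ i : Fin n, ∃ c s : ℝ, z ≤ (i : ℕ) → (i : ℕ) < z + m →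
      c ^ 2 + s ^ 2 = 1 ∧ c ^ 2 * μ i + s ^ 2 * μ (hbaP n z m i) = 0 ∧ c ≠ 0 ∧ s ≠ 0 := by
    intro i
    by_cases h : z ≤ (i : ℕ) ∧ (i : ℕ) < z + m
    · have hlt : μ i * μ (hbaP n z m i) < 0 := by
        have a1 := f1 i h.1 h.2
        have a2 := f2 (hbaP n z m i) (by
          rw [hbaP, dif_pos ⟨h.1, Or.inl h.2⟩]; simp only; omega)
        have := mul_neg_of_neg_of_pos a1 a2
        calc _ = ε ^ 2 * (μ i * μ (hbaP n z m i)) := by rw [hε, one_mul]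
          _ = _ := by ring
          _ < 0 := this
      obtain ⟨c, s, hh⟩ := hba_cs _ _ hlt
      exact ⟨c, s, fun _ _ => hh⟩
    · exact ⟨0, 0, fun h1 h2 => absurd ⟨h1, h2⟩ h⟩
  choose C S hCS using hcs
  set c : Fin n → ℝ := fun i => if z ≤ (i : ℕ) ∧ (i : ℕ) < z + m then C i
    else if n - m ≤ (i : ℕ) ∧ z ≤ (i : ℕ) then C (hbaP n z m i) else 1 with hc
  set s : Fin n → ℝ := fun i => if z ≤ (i : ℕ) ∧ (i : ℕ) < z + m then S i
    else if n - m ≤ (i : ℕ) ∧ z ≤ (i : ℕ) then - S (hbaP n z m i) else 0 with hs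
  -- facts on partner
  have pinv := fun i => hbaP_invol hzm i
  have p2 : ∀ i : Fin n, z ≤ (i : ℕ) → (i : ℕ) < z + m →
      n - m ≤ (hbaP n z m i : ℕ) := by
    intro i h1 h2
    rw [hbaP, dif_pos ⟨h1, Or.inl h2⟩]; simp only; omega
  have p4 : ∀ i : Fin n, n - m ≤ (i : ℕ) →
      z ≤ (hbaP n z m i : ℕ) ∧ (hbaP n z m i : ℕ) < z + m := by
    intro i h1
    rw [hbaP, dif_pos ⟨by omega, Or.inr h1⟩]; simp only; omega
  have p13 : ∀ i : Fin n, ((i : ℕ) < z ∨ z + m ≤ (i : ℕ) ∧ (i : ℕ) < n - m) →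
      hbaP n z m i = i := by
    intro i h
    rw [hbaP, dif_neg (by omega)]
  have cs2 : ∀ i : Fin n, z ≤ (i : ℕ) → (i : ℕ) < z + m → c i = C i ∧ s i = S i ∧
      c (hbaP n z m i) = C i ∧ s (hbaP n z m i) = - S i := by
    intro i h1 h2
    have h3 := p2 i h1 h2
    have h4 : ¬ (z ≤ (hbaP n z m i : ℕ) ∧ (hbaP n z m i : ℕ) < z + m) := by omega
    have h5 : n - m ≤ (hbaP n z m i : ℕ) ∧ z ≤ (hbaP n z m i : ℕ) := by omega
    simp only [hc, hs, if_pos (And.intro h1 h2), if_neg h4, if_pos h5, pinv, and_self]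
  have cs13 : ∀ i : Fin n, ((i : ℕ) < z ∨ z + m ≤ (i : ℕ) ∧ (i : ℕ) < n - m) →
      c i = 1 ∧ s i = 0 := by
    intro i h
    have h4 : ¬ (z ≤ (i : ℕ) ∧ (i : ℕ) < z + m) := by omega
    have h5 : ¬ (n - m ≤ (i : ℕ) ∧ z ≤ (i : ℕ)) := by omega
    simp only [hc, hs, if_neg h4, if_neg h5, and_self]
  have cases3 : ∀ i : Fin n, ((i : ℕ) < z ∨ z + m ≤ (i : ℕ) ∧ (i : ℕ) < n - m) ∨
      (z ≤ (i : ℕ) ∧ (i : ℕ) < z + m) ∨ n - m ≤ (i : ℕ) := by intro i; omega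
  have H1 : ∀ i, c i ^ 2 + s i ^ 2 = 1 := by
    intro i
    rcases cases3 i with h | h | h
    · obtain ⟨h1, h2⟩ := cs13 i h
      rw [h1, h2]; norm_num
    · obtain ⟨h1, h2, -, -⟩ := cs2 i h.1 h.2
      rw [h1, h2]; exact (hCS i h.1 h.2).1
    · obtain ⟨k1, k2⟩ := p4 i h
      obtain ⟨-, -, h1, h2⟩ := cs2 _ k1 k2
      rw [pinv] at h1 h2
      rw [h1, h2, neg_sq]; exact (hCS _ k1 k2).1
  have H2 : ∀ i, c i * s (hbaP n z m i) + s i * c (hbaP n z m i) = 0 := by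
    intro i
    rcases cases3 i with h | h | h
    · obtain ⟨h1, h2⟩ := cs13 i h
      rw [p13 i h, h1, h2]; norm_num
    · obtain ⟨h1, h2, h3, h4⟩ := cs2 i h.1 h.2
      rw [h1, h2, h3, h4]; ring
    · obtain ⟨k1, k2⟩ := p4 i h
      obtain ⟨h3, h4, h1, h2⟩ := cs2 _ k1 k2
      rw [pinv] at h1 h2
      rw [h1, h2, h3, h4]; ring
  set P : Matrix (Fin n) (Fin n) ℂ := Matrix.of fun k j => (if k = f j then (c j : ℂ) else 0)
      + (if k = f (hbaP n z m j) then (s j : ℂ) else 0) with hP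
  have comb := fun d => hba_comb f (hbaP n z m) pinv c s d P hP
  set U : Matrix (Fin n) (Fin n) ℂ := (hA.eigenvectorUnitary : Matrix (Fin n) (Fin n) ℂ) with hU
  have hUU : Uᴴ * U = 1 := by
    have := Unitary.coe_star_mul_self hA.eigenvectorUnitary
    simpa [Matrix.star_eq_conjTranspose] using this
  have hAU : A = U * Matrix.diagonal (fun k => (hA.eigenvalues k : ℂ)) * Uᴴ := by
    have := hA.spectral_theorem
    rw [Unitary.conjStarAlgAut_apply] at this
    exact this
  have hPP : Pᴴ * P = 1 := by
    ext i j
    have := comb (fun _ => 1) i j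
    simp only [mul_one, H1, H2] at this
    simpa [Matrix.one_apply] using this
  have hM : (U * P)ᴴ * A * (U * P) =
      Pᴴ * Matrix.diagonal (fun k => (hA.eigenvalues k : ℂ)) * P := by
    rw [Matrix.conjTranspose_mul]
    conv_lhs => rw [hAU]
    calc _ = Pᴴ * (Uᴴ * U) * Matrix.diagonal (fun k => (hA.eigenvalues k : ℂ)) * (Uᴴ * U) * P := by
          simp only [Matrix.mul_assoc]
      _ = _ := by rw [hUU]; simp only [Matrix.mul_one]
  refine ⟨U * P, fun i => c i ^ 2 * μ i + s i ^ 2 * μ (hbaP n z m i),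
    fun i => c i * s (hbaP n z m i) * μ i + s i * c (hbaP n z m i) * μ (hbaP n z m i),
    ?_, ?_, ?_, ?_, ?_, ?_, ?_⟩
  · rw [Matrix.conjTranspose_mul]
    calc _ = Pᴴ * (Uᴴ * U) * P := by simp only [Matrix.mul_assoc]
      _ = 1 := by rw [hUU, Matrix.mul_one, hPP]
  · intro i j
    rw [hM]
    exact comb hA.eigenvalues i j
  · intro i hi
    by_cases h : (i : ℕ) < z
    · simp only [p13 i (Or.inl h), f0 i h, mul_zero, add_zero]
    · obtain ⟨h1, h2, -, -⟩ := cs2 i (by omega) hi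
      simp only [h1, h2]
      exact (hCS i (by omega) hi).2.1
  · intro i h1 h2
    obtain ⟨k1, k2⟩ := cs13 i (Or.inr ⟨h1, h2⟩)
    have := f2 i h1
    simp only [k1, k2]
    simpa using this
  · intro i h
    simp only [p13 i (Or.inl h), f0 i h, mul_zero, add_zero]
  · intro i h1 h2
    obtain ⟨k1, k2⟩ := cs13 i (Or.inr ⟨h1, h2⟩)
    simp only [p13 i (Or.inr ⟨h1, h2⟩), k1, k2]; ring
  · intro i h
    obtain ⟨k1, k2⟩ := p4 i h
    obtain ⟨h3, h4, h1, h2⟩ := cs2 _ k1 k2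
    rw [pinv] at h1 h2
    obtain ⟨-, -, hC, hS⟩ := hCS _ k1 k2
    simp only [h1, h2, h3, h4]
    have e1 := f1 _ k1 k2
    have e2 := f2 i (by omega)
    have hne : μ i - μ (hbaP n z m i) ≠ 0 := by
      intro h0
      rw [sub_eq_zero.mp h0] at e2
      linarith
    have := mul_ne_zero (mul_ne_zero hC hS) hne
    intro h0
    apply this
    rw [← h0]; ring

/-- Block antitriangular form of a Hermitian indefinite matrix (Theorem 5.1).
If `A` is Hermitian with inertia `(n₋, n₀, n₊)`, `n₋, n₊ > 0`,
`n₁ = min(n₋,n₊)`, `n₂ = max(n₋,n₊) - n₁`, then there is a unitary `Q` such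
that `M = Qᴴ A Q` has the block form (block sizes `n₀, n₁, n₂, n₁`)
`[[0,0,0,0],[0,0,0,Y*],[0,0,X,Z*],[0,Y,Z,W]]` with `Y` nonsingular lower
antitriangular, `X` Hermitian definite, and `W` Hermitian. -/
theorem hermitian_block_antitriangular {n nneg nzero npos n1 n2 : ℕ}
    (A : Matrix (Fin n) (Fin n) ℂ) (hA : A.IsHermitian)
    (hneg : (Finset.univ.filter fun i => hA.eigenvalues i < 0).card = nneg)
    (hzero : (Finset.univ.filter fun i => hA.eigenvalues i = 0).card = nzero)
    (hpos : (Finset.univ.filter fun i => 0 < hA.eigenvalues i).card = npos)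
    (hsum : nneg + nzero + npos = n)
    (hn1 : n1 = min nneg npos) (hn2 : n2 = max nneg npos - n1)
    (hindef : 0 < nneg ∧ 0 < npos) :
    ∃ Q : Matrix (Fin n) (Fin n) ℂ, Qᴴ * Q = 1 ∧
      -- first block row and column (size n₀) are zero
      (∀ i j : Fin n, ((i : ℕ) < nzero ∨ (j : ℕ) < nzero) → (Qᴴ * A * Q) i j = 0) ∧
      -- blocks (2,2) and (2,3) are zero
      (∀ i j : Fin n, nzero ≤ (i : ℕ) → (i : ℕ) < nzero + n1 →
        nzero ≤ (j : ℕ) → (j : ℕ) < nzero + n1 + n2 → (Qᴴ * A * Q) i j = 0) ∧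
      -- block (3,2) is zero
      (∀ i j : Fin n, nzero + n1 ≤ (i : ℕ) → (i : ℕ) < nzero + n1 + n2 →
        nzero ≤ (j : ℕ) → (j : ℕ) < nzero + n1 → (Qᴴ * A * Q) i j = 0) ∧
      -- Y (block (4,2)) is lower antitriangular
      (∀ a b : Fin n1, (a : ℕ) + (b : ℕ) + 2 ≤ n1 →
        (Qᴴ * A * Q) ⟨nzero + n1 + n2 + (a : ℕ), by have := a.isLt; omega⟩
          ⟨nzero + (b : ℕ), by have := b.isLt; omega⟩ = 0) ∧
      -- Y is nonsingular
      IsUnit (Matrix.of fun a b : Fin n1 =>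
        (Qᴴ * A * Q) ⟨nzero + n1 + n2 + (a : ℕ), by have := a.isLt; omega⟩
          ⟨nzero + (b : ℕ), by have := b.isLt; omega⟩).det ∧
      -- X (block (3,3)) is Hermitian and definite
      (Matrix.of fun a b : Fin n2 =>
        (Qᴴ * A * Q) ⟨nzero + n1 + (a : ℕ), by have := a.isLt; omega⟩
          ⟨nzero + n1 + (b : ℕ), by have := b.isLt; omega⟩).IsHermitian ∧
      ((Matrix.of fun a b : Fin n2 =>
        (Qᴴ * A * Q) ⟨nzero + n1 + (a : ℕ), by have := a.isLt; omega⟩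
          ⟨nzero + n1 + (b : ℕ), by have := b.isLt; omega⟩).PosDef ∨
       (-(Matrix.of fun a b : Fin n2 =>
        (Qᴴ * A * Q) ⟨nzero + n1 + (a : ℕ), by have := a.isLt; omega⟩
          ⟨nzero + n1 + (b : ℕ), by have := b.isLt; omega⟩)).PosDef) ∧
      -- W (block (4,4)) is Hermitian
      (Matrix.of fun a b : Fin n1 =>
        (Qᴴ * A * Q) ⟨nzero + n1 + n2 + (a : ℕ), by have := a.isLt; omega⟩
          ⟨nzero + n1 + n2 + (b : ℕ), by have := b.isLt; omega⟩).IsHermitian := by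
  obtain ⟨ε, hε, hm⟩ : ∃ ε : ℝ, (ε = 1 ∨ ε = -1) ∧
      (Finset.univ.filter fun i => ε * hA.eigenvalues i < 0).card = n1 := by
    rcases le_total nneg npos with h | h
    · refine ⟨1, Or.inl rfl, ?_⟩
      simp only [one_mul]; omega
    · refine ⟨-1, Or.inr rfl, ?_⟩
      simp only [neg_mul, one_mul, Left.neg_neg_iff]; omega
  have hε2 : ε ^ 2 = 1 := by rcases hε with h | h <;> rw [h] <;> norm_num
  have hn : nzero + n1 + n2 + n1 = n := by omega
  obtain ⟨Q, d, y, hQ, hM, d12, d3, y1, y3, y4⟩ :=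
    hba_main (z := nzero) (m := n1) (by omega) ε hε2 A hA hzero hm
  have hH : (Qᴴ * A * Q).IsHermitian := Matrix.isHermitian_conjTranspose_mul_mul Q hA
  have hXeq : (Matrix.of fun a b : Fin n2 =>
        (Qᴴ * A * Q) ⟨nzero + n1 + (a : ℕ), by have := a.isLt; omega⟩
          ⟨nzero + n1 + (b : ℕ), by have := b.isLt; omega⟩) =
      Matrix.diagonal fun a : Fin n2 =>
        (d ⟨nzero + n1 + (a : ℕ), by have := a.isLt; omega⟩ : ℂ) := by
    ext a b
    have ha := a.isLt
    rw [Matrix.of_apply, hM, y3 _ (by simp only; omega) (by simp only; omega),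
      Matrix.diagonal_apply]
    simp [Fin.ext_iff]
  have hPval : ∀ j : Fin n, nzero ≤ (j : ℕ) → (j : ℕ) < nzero + n1 →
      (hbaP n nzero n1 j : ℕ) = n - 1 + nzero - j := by
    intro j h1 h2
    rw [hbaP, dif_pos ⟨h1, Or.inl h2⟩]
  have hz1 : ∀ i j : Fin n, (i : ℕ) < nzero → (Qᴴ * A * Q) i j = 0 := by
    intro i j h
    rw [hM, d12 i (by omega), y1 i h]; simp
  have h22 : ∀ i j : Fin n, nzero ≤ (i : ℕ) → (i : ℕ) < nzero + n1 →
        nzero ≤ (j : ℕ) → (j : ℕ) < nzero + n1 + n2 → (Qᴴ * A * Q) i j = 0 := by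
    intro i j h1 h2 h3 h4
    rw [hM, d12 i h2, if_neg (show ¬ (i = hbaP n nzero n1 j) from ?_)]
    · simp
    · intro h
      have hv := congrArg Fin.val h
      by_cases h5 : (j : ℕ) < nzero + n1
      · rw [hPval j h3 h5] at hv; omega
      · rw [hbaP, dif_neg (by omega)] at hv; omega
  have hY : ∀ a b : Fin n1, (Qᴴ * A * Q) ⟨nzero + n1 + n2 + (a : ℕ), by have := a.isLt; omega⟩
          ⟨nzero + (b : ℕ), by have := b.isLt; omega⟩ =
      if a = Fin.rev b then
        (y ⟨nzero + n1 + n2 + (a : ℕ), by have := a.isLt; omega⟩ : ℂ) else 0 := by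
    intro a b
    have ha := a.isLt
    have hb := b.isLt
    rw [hM, if_neg (by rw [Fin.ext_iff]; simp only; omega), zero_add]
    refine if_congr ?_ rfl rfl
    rw [Fin.ext_iff, Fin.ext_iff, hPval _ (by simp only; omega) (by simp only; omega), Fin.val_rev]
    simp only
    omega
  refine ⟨Q, hQ, ?_, h22, ?_, ?_, ?_, ?_, ?_, ?_⟩
  · rintro i j (h | h)
    · exact hz1 i j h
    · rw [← hH.apply, hz1 j i h, star_zero]
  · intro i j h1 h2 h3 h4
    rw [← hH.apply, h22 j i h3 h4 (by omega) h2, star_zero]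
  · intro a b hab
    rw [hY, if_neg]
    rw [Fin.ext_iff, Fin.val_rev]; omega
  · have hYeq : (Matrix.of fun a b : Fin n1 =>
        (Qᴴ * A * Q) ⟨nzero + n1 + n2 + (a : ℕ), by have := a.isLt; omega⟩
          ⟨nzero + (b : ℕ), by have := b.isLt; omega⟩) =
        (Matrix.diagonal fun a : Fin n1 =>
          (y ⟨nzero + n1 + n2 + (a : ℕ), by have := a.isLt; omega⟩ : ℂ)).submatrix id
          (Fin.revPerm : Equiv.Perm (Fin n1)) := by
      ext a b
      rw [Matrix.of_apply, hY, Matrix.submatrix_apply, Matrix.diagonal_apply]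
      rfl
    rw [hYeq, Matrix.det_permute', Matrix.det_diagonal, isUnit_iff_ne_zero]
    refine mul_ne_zero ?_ (Finset.prod_ne_zero_iff.mpr fun a _ => ?_)
    · rcases Int.units_eq_one_or (Equiv.Perm.sign (Fin.revPerm : Equiv.Perm (Fin n1))) with h | h <;>
        rw [h] <;> simp
    · exact_mod_cast y4 _ (by simp only; omega)
  · ext a b
    exact hH.apply _ _
  · rw [hXeq]
    have hd : ∀ a : Fin n2, 0 < ε * d ⟨nzero + n1 + (a : ℕ), by have := a.isLt; omega⟩ := by
      intro a
      have := a.isLt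
      exact d3 _ (by simp only; omega) (by simp only; omega)
    rcases hε with h | h
    · left
      refine Matrix.PosDef.diagonal fun a => ?_
      have := hd a
      subst h
      rw [one_mul] at this
      exact_mod_cast this
    · right
      rw [Matrix.diagonal_neg]
      refine Matrix.PosDef.diagonal fun a => ?_
      have := hd a
      subst h
      rw [neg_one_mul] at this
      simp only [← Complex.ofReal_neg]
      exact_mod_cast this
  · ext a b
    exact hH.apply _ _
end

section
/- Let A ∈ ℂ^{n×n} be skew-Hermitian with n₋ eigenvalues having negative imaginary part, n₀ zero eigenvalues, and n₊ eigenvalues with positive imaginary part, where neither n₋ = n nor n₊ = n; set n₁ = min(n₋,n₊), n₂ = max(n₋,n₊) - n₁. Then there exists a unitary Q such that M = Q*AQ = [[0,0,0,0],[0,0,0,-Y*],[0,0,X,-Z*],[0,Y,Z,W]] with block sizes (n₀,n₁,n₂,n₁), where Y is nonsingular lower antitriangular, X and W are skew-Hermitian, and all eigenvalues of X lie on the same open half of the imaginary axis. -/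
open Matrix ComplexOrder

lemma core_entry {n : ℕ} (σ : Fin n → Fin n) (hσ : ∀ i, σ (σ i) = i) (a b d : Fin n → ℝ)
    (j k : Fin n) :
    ((Matrix.of fun i j => (if i = j then a j else 0) + (if i = σ j then b j else 0) : Matrix (Fin n) (Fin n) ℝ)ᵀ * diagonal d *
      (Matrix.of fun i j => (if i = j then a j else 0) + (if i = σ j then b j else 0))) j k =
    (if j = k then a j * a j * d j + b j * b j * d (σ j) else 0)
      + (if j = σ k then a j * d j * b k + b j * d k * a k else 0) := by
  have h1 : ∀ x y : Fin n, x = σ y ↔ σ x = y := fun x y =>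
    ⟨fun h => by rw [h, hσ], fun h => by rw [← h, hσ]⟩
  rw [Matrix.mul_apply]
  simp only [mul_diagonal, transpose_apply, of_apply, add_mul, mul_add, Finset.sum_add_distrib,
    ite_mul, mul_ite, zero_mul, mul_zero, Finset.sum_ite_eq, Finset.sum_ite_eq', Finset.mem_univ, if_true]
  by_cases h : j = k
  · subst h
    by_cases h2 : j = σ j
    · have h3 := h2.symm
      simp [h3]; ring
    · have h3 : ¬ σ j = j := fun h => h2 h.symm
      simp [h2, h3]; ring
  · by_cases h2 : j = σ k
    · subst h2
      have h3 : ¬ k = σ k := fun hh => h hh.symm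
      simp [hσ, h, h3]; ring
    · have h3 : ¬ σ j = k := fun hh => h2 ((h1 _ _).2 hh)
      have h4 : ¬ k = σ j := fun hh => h3 hh.symm
      have h5 : ¬ σ j = σ k := fun hh => h (by rw [← hσ j, hh, hσ])
      have h6 : ¬ σ k = j := fun hh => h2 hh.symm
      have h7 : ¬ k = j := fun hh => h hh.symm
      have h8 : ¬ σ k = σ j := fun hh => h5 hh.symm
      simp [h, h2, h3, h4, h5, h6, h7, h8]

lemma core {n z n1 n2 : ℕ} (hn : n = z + n1 + n2 + n1) (d : Fin n → ℝ) (ε : ℝ)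
    (h0 : ∀ i : Fin n, (i : ℕ) < z → d i = 0)
    (hp : ∀ i : Fin n, z ≤ (i : ℕ) → (i : ℕ) < z + n1 + n2 → 0 < ε * d i)
    (hm : ∀ i : Fin n, z + n1 + n2 ≤ (i : ℕ) → ε * d i < 0) :
    ∃ R : Matrix (Fin n) (Fin n) ℝ, Rᵀ * R = 1 ∧
      (∀ i j : Fin n, ((i : ℕ) < z ∨ (j : ℕ) < z) → (Rᵀ * diagonal d * R) i j = 0) ∧
      (∀ i j : Fin n, i ≠ j → (i : ℕ) + j + 1 ≠ n + z → (Rᵀ * diagonal d * R) i j = 0) ∧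
      (∀ i : Fin n, z ≤ (i : ℕ) → (i : ℕ) < z + n1 → (Rᵀ * diagonal d * R) i i = 0) ∧
      (∀ i j : Fin n, i ≠ j → z + n1 ≤ (i : ℕ) → (i : ℕ) < z + n1 + n2 →
        (Rᵀ * diagonal d * R) i j = 0) ∧
      (∀ i : Fin n, z + n1 ≤ (i : ℕ) → (i : ℕ) < z + n1 + n2 →
        0 < ε * (Rᵀ * diagonal d * R) i i) ∧
      (∀ i j : Fin n, z + n1 + n2 ≤ (i : ℕ) → (i : ℕ) + j + 1 = n + z →
        (Rᵀ * diagonal d * R) i j ≠ 0) := by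
  classical
  let σ : Fin n → Fin n := fun i =>
    if h : (z ≤ (i : ℕ) ∧ (i : ℕ) < z + n1) ∨ z + n1 + n2 ≤ (i : ℕ) then
      ⟨n + z - 1 - i, by have := i.isLt; omega⟩ else i
  have σval : ∀ i : Fin n, ((σ i : Fin n) : ℕ) =
      if (z ≤ (i : ℕ) ∧ (i : ℕ) < z + n1) ∨ z + n1 + n2 ≤ (i : ℕ) then n + z - 1 - i else i := by
    intro i
    simp only [σ]; split_ifs <;> rfl
  have hσ : ∀ i, σ (σ i) = i := by
    intro i
    apply Fin.ext
    have := i.isLt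
    rw [σval, σval]
    split_ifs <;> omega
  let t : Fin n → ℝ := fun i => |d i| + |d (σ i)|
  let p2 : Fin n → Prop := fun i => z ≤ (i : ℕ) ∧ (i : ℕ) < z + n1
  let p4 : Fin n → Prop := fun i => z + n1 + n2 ≤ (i : ℕ)
  let a : Fin n → ℝ := fun i => if p2 i then √(|d (σ i)| / t i) else
    if p4 i then - √(|d i| / t i) else 1
  let b : Fin n → ℝ := fun i => if p2 i then √(|d i| / t i) else
    if p4 i then √(|d (σ i)| / t i) else 0
  have σ2 : ∀ i, p2 i → p4 (σ i) := by
    intro i hi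
    have := i.isLt
    simp only [p2, p4] at *
    rw [σval]; split_ifs <;> omega
  have σ4 : ∀ i, p4 i → p2 (σ i) := by
    intro i hi
    have := i.isLt
    simp only [p2, p4] at *
    rw [σval]; split_ifs <;> omega
  have σ3 : ∀ i, ¬ p2 i → ¬ p4 i → σ i = i := by
    intro i hi h
    apply Fin.ext
    simp only [p2, p4] at *
    rw [σval]; split_ifs <;> omega
  have n24 : ∀ i, p2 i → ¬ p4 i := by
    intro i hi; simp only [p2, p4] at *; omega
  have nn : ∀ i, p2 i ∨ p4 i → d i ≠ 0 := by
    rintro i (hi | hi) h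
    · have := hp i hi.1 (by have := hi.2; omega)
      simp [h] at this
    · have := hm i hi
      simp [h] at this
  have opp : ∀ i, p2 i ∨ p4 i → d i * |d (σ i)| + d (σ i) * |d i| = 0 := by
    have key : ∀ x y : ℝ, 0 < ε * x → ε * y < 0 → x * |y| + y * |x| = 0 := by
      intro x y hx hy
      rcases lt_trichotomy ε 0 with he | he | he
      · rw [abs_of_neg (by nlinarith : x < 0), abs_of_pos (by nlinarith : 0 < y)]; ring
      · simp [he] at hx
      · rw [abs_of_pos (by nlinarith : 0 < x), abs_of_neg (by nlinarith : y < 0)]; ring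
    rintro i (hi | hi)
    · exact key _ _ (hp i hi.1 (by have := hi.2; omega)) (hm _ (σ2 i hi))
    · have := σ4 i hi
      rw [add_comm]
      exact key _ _ (hp _ this.1 (by have := this.2; omega)) (hm _ hi)
  have tpos : ∀ i, p2 i ∨ p4 i → 0 < t i := by
    intro i hi
    have := abs_pos.2 (nn i hi)
    have := abs_nonneg (d (σ i))
    simp only [t]; linarith
  have tσ : ∀ i, t (σ i) = t i := by intro i; simp only [t, hσ]; ring
  have sq : ∀ i x, p2 i ∨ p4 i → √(|x| / t i) * √(|x| / t i) = |x| / t i := fun i x hi =>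
    Real.mul_self_sqrt (div_nonneg (abs_nonneg _) (tpos i hi).le)
  have aa : ∀ i, p2 i → a i * a i = |d (σ i)| / t i := by
    intro i hi
    rw [← sq i _ (Or.inl hi)]
    simp only [a, if_pos hi]
  have bb : ∀ i, p2 i → b i * b i = |d i| / t i := by
    intro i hi
    rw [← sq i _ (Or.inl hi)]
    simp only [b, if_pos hi]
  have a3 : ∀ i, ¬ p2 i → ¬ p4 i → a i = 1 := by intro i h h'; simp [a, h, h']
  have b3 : ∀ i, ¬ p2 i → ¬ p4 i → b i = 0 := by intro i h h'; simp [b, h, h']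
  have ab4 : ∀ i, p4 i → a i = - a (σ i) ∧ b i = b (σ i) := by
    intro i hi
    have h2 := σ4 i hi
    have h2' : ¬ p2 i := fun h => n24 i h hi
    simp [a, b, hi, h2, h2', hσ, tσ]
  have ab2 : ∀ i, p2 i → a i = - a (σ i) ∧ b i = b (σ i) := by
    intro i hi
    have := ab4 (σ i) (σ2 i hi)
    rw [hσ] at this
    constructor <;> linarith [this.1, this.2]
  have e2 : ∀ j, p2 j → a j * a j + b j * b j = 1 := by
    intro j h2
    rw [aa j h2, bb j h2, ← add_div, add_comm]
    exact div_self (tpos j (Or.inl h2)).ne'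
  have σne : ∀ i, p2 i ∨ p4 i → i ≠ σ i := by
    rintro i (hi | hi) h
    · exact n24 i hi (h ▸ σ2 i hi)
    · exact n24 i (h ▸ σ4 i hi) hi
  have hM := core_entry σ hσ a b
  refine ⟨Matrix.of fun i j => (if i = j then a j else 0) + (if i = σ j then b j else 0), ?_, ?_, ?_, ?_, ?_, ?_, ?_⟩
  · ext j k
    have := hM (fun _ => 1) j k
    rw [diagonal_one, Matrix.mul_one] at this
    rw [this, Matrix.one_apply]
    by_cases h2 : p2 j ∨ p4 j
    · have e1 : a j * a j + b j * b j = 1 := by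
        rcases h2 with h2 | h2
        · exact e2 j h2
        · rw [(ab4 j h2).1, (ab4 j h2).2, ← e2 _ (σ4 j h2)]; ring
      by_cases h : j = k
      · subst h
        simp [σne j h2, e1]
      · by_cases h' : j = σ k
        · have hk : k = σ j := by rw [h', hσ]
          rw [if_neg h, if_pos h', if_neg h, hk]
          rcases h2 with h2 | h2
          · rw [(ab2 j h2).1, (ab2 j h2).2]; ring
          · rw [(ab4 j h2).1, (ab4 j h2).2]; ring
        · simp [h, h']
    · push Not at h2
      have := σ3 j h2.1 h2.2
      by_cases h : j = k
      · subst h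
        simp [this, a3 j h2.1 h2.2, b3 j h2.1 h2.2]
      · have h' : ¬ j = σ k := fun hh => h (by rw [← this, hh, hσ])
        simp [h, h']
  · have hz : ∀ i : Fin n, (i : ℕ) < z → ¬ p2 i ∧ ¬ p4 i := by
      intro i hi; simp only [p2, p4]; omega
    intro i j hij
    rw [hM]
    have : (i = j ∨ i = σ j) → i = j ∧ σ i = i ∧ (i : ℕ) < z := by
      intro hh
      rcases hij with h | h
      · have h3 := σ3 i (hz i h).1 (hz i h).2
        refine ⟨?_, h3, h⟩
        rcases hh with hh | hh
        · exact hh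
        · rw [← h3, hh, hσ]
      · have h3 := σ3 j (hz j h).1 (hz j h).2
        have : i = j := by rw [h3] at hh; tauto
        subst this
        exact ⟨rfl, h3, h⟩
    by_cases hh : i = j ∨ i = σ j
    · obtain ⟨rfl, h1, h2⟩ := this hh
      simp [h1, h0 i h2]
    · push Not at hh
      simp [hh.1, hh.2]
  · intro i j hij hs
    rw [hM, if_neg hij, if_neg, add_zero]
    intro h
    have h1 := congrArg Fin.val h
    have h2 : (i : ℕ) ≠ j := fun h => hij (Fin.ext h)
    have := i.isLt
    have := j.isLt
    rw [σval] at h1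
    split_ifs at h1 <;> omega
  · intro i hi1 hi2
    have h2 : p2 i ∨ p4 i := Or.inl ⟨hi1, hi2⟩
    rw [hM, if_pos rfl, if_neg (σne i h2), aa i ⟨hi1, hi2⟩, bb i ⟨hi1, hi2⟩]
    have := opp i h2
    rw [add_zero, div_mul_eq_mul_div, div_mul_eq_mul_div, ← add_div, div_eq_zero_iff]
    left; linarith
  · intro i j hij hi1 hi2
    have h3 := σ3 i (by simp only [p2]; omega) (by simp only [p4]; omega)
    rw [hM, if_neg hij, if_neg, add_zero]
    intro h
    exact hij (by rw [← h3, h, hσ])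
  · intro i hi1 hi2
    have q2 : ¬ p2 i := by simp only [p2]; omega
    have q4 : ¬ p4 i := by simp only [p4]; omega
    rw [hM, a3 i q2 q4, b3 i q2 q4]
    simpa using hp i (by omega) hi2
  · intro i j hi hij
    have h4 : p4 i := hi
    have hj : i = σ j := by
      apply Fin.ext
      have := i.isLt
      rw [σval]; split_ifs <;> omega
    have hj' : j = σ i := by rw [hj, hσ]
    have hne := σne i (Or.inr h4)
    rw [hM, if_neg (by rw [hj']; exact hne), if_pos hj, zero_add]
    have h2j : p2 j := hj' ▸ σ4 i h4
    have hb : b i = b j := by rw [(ab4 i h4).2, hj']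
    have ha : a i = - a j := by rw [(ab4 i h4).1, hj']
    rw [hb, ha]
    have e1 : -a j * d i * b j + b j * d j * a j = a j * b j * (d j - d i) := by ring
    have hti := tpos j (Or.inl h2j)
    have haj : a j ≠ 0 := by
      intro h
      have := aa j h2j
      rw [h, ← hj] at this
      have h3 := abs_pos.2 (nn i (Or.inr h4))
      have : 0 < |d i| / t j := by positivity
      linarith
    have hbj : b j ≠ 0 := by
      intro h
      have := bb j h2j
      rw [h] at this
      have h3 := abs_pos.2 (nn j (Or.inl h2j))
      have : 0 < |d j| / t j := by positivity
      linarith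
    rw [e1]
    refine mul_ne_zero (mul_ne_zero haj hbj) fun h => ?_
    have h5 := hm i hi
    have h6 := hp j h2j.1 (by have := h2j.2; omega)
    rw [show d j = d i by linarith] at h6
    linarith

lemma reorder {n z p q : ℕ} (hn : n = z + p + q) (ev : Fin n → ℝ) (ε : ℝ) (hε : ε ≠ 0)
    (hz : (Finset.univ.filter fun i => ev i = 0).card = z)
    (hp : (Finset.univ.filter fun i => 0 < ε * ev i).card = p)
    (hq : (Finset.univ.filter fun i => ε * ev i < 0).card = q) :
    ∃ e : Fin n ≃ Fin n, (∀ i : Fin n, (i : ℕ) < z → ev (e i) = 0) ∧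
      (∀ i : Fin n, z ≤ (i : ℕ) → (i : ℕ) < z + p → 0 < ε * ev (e i)) ∧
      (∀ i : Fin n, z + p ≤ (i : ℕ) → ε * ev (e i) < 0) := by
  classical
  let f : Fin n → Fin 3 := fun i => if (i : ℕ) < z then 0 else if (i : ℕ) < z + p then 1 else 2
  let g : Fin n → Fin 3 := fun i => if ev i = 0 then 0 else if 0 < ε * ev i then 1 else 2
  have cnt : ∀ a b : ℕ, a ≤ b → b ≤ n →
      (Finset.univ.filter fun i : Fin n => a ≤ (i : ℕ) ∧ (i : ℕ) < b).card = b - a := by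
    intro a b _ hb
    rw [← Nat.card_Ico a b]
    refine Finset.card_bij (fun i _ => (i : ℕ)) ?_ ?_ ?_
    · intro i hi; simpa using hi
    · intro i _ j _ h; exact Fin.ext h
    · intro k hk
      have := Finset.mem_Ico.1 hk
      exact ⟨⟨k, by omega⟩, by simpa using this, rfl⟩
  have hc : ∀ c : Fin 3, Fintype.card {i // f i = c} = Fintype.card {i // g i = c} := by
    intro c
    rw [Fintype.card_subtype, Fintype.card_subtype]
    fin_cases c
    · have h1 := cnt 0 z (by omega) (by omega)
      rw [Nat.sub_zero, ← hz] at h1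
      convert h1 using 2
      · ext i; simp only [f]; simp; split_ifs <;> simp_all
      · ext i; simp only [g]; simp; split_ifs <;> simp_all
    · have h1 := cnt z (z + p) (by omega) (by omega)
      rw [Nat.add_sub_cancel_left, ← hp] at h1
      convert h1 using 2
      · ext i; simp only [f]; simp; split_ifs <;> simp <;> omega
      · ext i; simp only [g]; simp; split_ifs <;> simp_all
    · have h1 := cnt (z + p) n (by omega) (by omega)
      rw [show n - (z + p) = q by omega, ← hq] at h1
      convert h1 using 2
      · ext i; simp only [f]; simp; split_ifs <;> simp <;> omega
      · ext i; simp only [g]; simp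
        have : ev i ≠ 0 → ε * ev i ≠ 0 := fun h => mul_ne_zero hε h
        split_ifs with h1 h2
        · simp [h1]
        · simp [h2.le]
        · simp; exact lt_of_le_of_ne (not_lt.1 h2) (this h1)
  let e : Fin n ≃ Fin n := Equiv.ofFiberEquiv (f := f) (g := g)
    (fun c => Fintype.equivOfCardEq (hc c))
  have he : ∀ i, g (e i) = f i := fun i => Equiv.ofFiberEquiv_map _ i
  refine ⟨e, ?_, ?_, ?_⟩
  · intro i hi
    have := he i
    simp only [f, g, if_pos hi] at this
    split_ifs at this with h1 h2
    · exact h1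
    all_goals simp at this
  · intro i hi hi2
    have := he i
    simp only [f, g, if_neg (not_lt.2 hi), if_pos hi2] at this
    split_ifs at this with h1 h2
    · simp at this
    · exact h2
    · simp at this
  · intro i hi
    have := he i
    simp only [f, g, if_neg (not_lt.2 hi), if_neg (by omega : ¬ (i : ℕ) < z)] at this
    split_ifs at this with h1 h2
    · simp at this
    · simp at this
    · exact lt_of_le_of_ne (not_lt.1 h2) (mul_ne_zero hε h1)

lemma assemble {n : ℕ} (A : Matrix (Fin n) (Fin n) ℂ) (hH : (Complex.I • A).IsHermitian)
    (e : Fin n ≃ Fin n) (R : Matrix (Fin n) (Fin n) ℝ) (hR : Rᵀ * R = 1) :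
    ∃ Q : Matrix (Fin n) (Fin n) ℂ, Qᴴ * Q = 1 ∧ ∀ i j, (Qᴴ * A * Q) i j =
      -Complex.I * ((Rᵀ * diagonal (fun i => hH.eigenvalues (e i)) * R) i j : ℝ) := by
  let U : Matrix (Fin n) (Fin n) ℂ := hH.eigenvectorUnitary
  have hU : Uᴴ * U = 1 := Unitary.coe_star_mul_self hH.eigenvectorUnitary
  have hD : Uᴴ * A * U = -Complex.I • diagonal (fun i => (hH.eigenvalues i : ℂ)) := by
    have h := hH.conjStarAlgAut_star_eigenvectorUnitary
    rw [Unitary.conjStarAlgAut_star_apply] at h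
    have h' : Uᴴ * (Complex.I • A) * U = diagonal (fun i => (hH.eigenvalues i : ℂ)) := h
    rw [← h', Matrix.mul_smul, Matrix.smul_mul, smul_smul]
    simp
  let V := U.submatrix id e
  have hV : Vᴴ * V = 1 := by
    have : Vᴴ * V = (Uᴴ * U).submatrix e e := by
      rw [Matrix.submatrix_mul _ _ e id e Function.bijective_id]; rfl
    rw [this, hU, Matrix.submatrix_one_equiv]
  have hVA : Vᴴ * A * V = -Complex.I • diagonal (fun i => (hH.eigenvalues (e i) : ℂ)) := by
    have : Vᴴ * A * V = (Uᴴ * A * U).submatrix e e := by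
      rw [Matrix.submatrix_mul _ _ e id e Function.bijective_id,
        Matrix.submatrix_mul _ _ e id id Function.bijective_id]; rfl
    rw [this, hD]
    ext i j
    simp only [submatrix_apply, Matrix.smul_apply, diagonal_apply, e.injective.eq_iff]
  let S : Matrix (Fin n) (Fin n) ℂ := R.map Complex.ofReal
  have hS : Sᴴ = (Rᵀ).map Complex.ofReal := by
    ext i j; simp [S]
  refine ⟨V * S, ?_, ?_⟩
  · rw [conjTranspose_mul, Matrix.mul_assoc, ← Matrix.mul_assoc Vᴴ, hV, Matrix.one_mul, hS]
    have := congrArg (fun M => M.map Complex.ofRealHom) hR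
    simp only [Matrix.map_mul] at this
    refine this.trans ?_
    ext i j; simp [Matrix.one_apply]
  · intro i j
    have h1 : (V * S)ᴴ * A * (V * S) = Sᴴ * (Vᴴ * A * V) * S := by
      simp only [conjTranspose_mul, Matrix.mul_assoc]
    have h2 : (Rᵀ * diagonal (fun i => hH.eigenvalues (e i)) * R).map Complex.ofRealHom =
        Sᴴ * diagonal (fun i => (hH.eigenvalues (e i) : ℂ)) * S := by
      rw [Matrix.map_mul, Matrix.map_mul, hS]
      congr 2
      ext i j; simp [diagonal_apply]; split_ifs <;> simp
    rw [h1, hVA, Matrix.mul_smul, Matrix.smul_mul, ← h2]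
    rfl

/-- Block antitriangular form of a skew-Hermitian matrix (Corollary 5.2).
Let `A` be skew-Hermitian with `n₋` eigenvalues of negative imaginary part,
`n₀` zero eigenvalues and `n₊` eigenvalues of positive imaginary part (counted
via the real eigenvalues of the Hermitian matrix `iA`: an eigenvalue `μ = -iλ`
of `A` has `μ.im < 0` iff the eigenvalue `λ` of `iA` is positive), with
`n₋ ≠ n` and `n₊ ≠ n`, `n₁ = min(n₋,n₊)`, `n₂ = max(n₋,n₊) - n₁`.  Then there
is a unitary `Q` such that `M = Qᴴ A Q` has block form (block sizes
`n₀, n₁, n₂, n₁`) `[[0,0,0,0],[0,0,0,-Y*],[0,0,X,-Z*],[0,Y,Z,W]]` with `Y`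
nonsingular lower antitriangular, `X` and `W` skew-Hermitian, and all
eigenvalues of `X` on the same open half of the imaginary axis. -/
theorem skew_hermitian_block_antitriangular {n nneg nzero npos n1 n2 : ℕ}
    (A : Matrix (Fin n) (Fin n) ℂ) (hA : Aᴴ = -A)
    (hH : (Complex.I • A).IsHermitian)
    (hneg : (Finset.univ.filter fun i => 0 < hH.eigenvalues i).card = nneg)
    (hzero : (Finset.univ.filter fun i => hH.eigenvalues i = 0).card = nzero)
    (hpos : (Finset.univ.filter fun i => hH.eigenvalues i < 0).card = npos)
    (hsum : nneg + nzero + npos = n)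
    (hn1 : n1 = min nneg npos) (hn2 : n2 = max nneg npos - n1)
    (hnot : nneg ≠ n ∧ npos ≠ n) :
    ∃ Q : Matrix (Fin n) (Fin n) ℂ, Qᴴ * Q = 1 ∧
      -- first block row and column (size n₀) are zero
      (∀ i j : Fin n, ((i : ℕ) < nzero ∨ (j : ℕ) < nzero) → (Qᴴ * A * Q) i j = 0) ∧
      -- blocks (2,2) and (2,3) are zero
      (∀ i j : Fin n, nzero ≤ (i : ℕ) → (i : ℕ) < nzero + n1 →
        nzero ≤ (j : ℕ) → (j : ℕ) < nzero + n1 + n2 → (Qᴴ * A * Q) i j = 0) ∧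
      -- block (3,2) is zero
      (∀ i j : Fin n, nzero + n1 ≤ (i : ℕ) → (i : ℕ) < nzero + n1 + n2 →
        nzero ≤ (j : ℕ) → (j : ℕ) < nzero + n1 → (Qᴴ * A * Q) i j = 0) ∧
      -- Y (block (4,2)) is lower antitriangular
      (∀ a b : Fin n1, (a : ℕ) + (b : ℕ) + 2 ≤ n1 →
        (Qᴴ * A * Q) ⟨nzero + n1 + n2 + (a : ℕ), by have := a.isLt; omega⟩
          ⟨nzero + (b : ℕ), by have := b.isLt; omega⟩ = 0) ∧
      -- Y is nonsingular
      IsUnit (Matrix.of fun a b : Fin n1 =>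
        (Qᴴ * A * Q) ⟨nzero + n1 + n2 + (a : ℕ), by have := a.isLt; omega⟩
          ⟨nzero + (b : ℕ), by have := b.isLt; omega⟩).det ∧
      -- X (block (3,3)) is skew-Hermitian with all eigenvalues on the same
      -- open half of the imaginary axis
      (Matrix.of fun a b : Fin n2 =>
        (Qᴴ * A * Q) ⟨nzero + n1 + (a : ℕ), by have := a.isLt; omega⟩
          ⟨nzero + n1 + (b : ℕ), by have := b.isLt; omega⟩)ᴴ =
      -(Matrix.of fun a b : Fin n2 =>
        (Qᴴ * A * Q) ⟨nzero + n1 + (a : ℕ), by have := a.isLt; omega⟩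
          ⟨nzero + n1 + (b : ℕ), by have := b.isLt; omega⟩) ∧
      ((∀ μ ∈ spectrum ℂ (Matrix.of fun a b : Fin n2 =>
        (Qᴴ * A * Q) ⟨nzero + n1 + (a : ℕ), by have := a.isLt; omega⟩
          ⟨nzero + n1 + (b : ℕ), by have := b.isLt; omega⟩), 0 < μ.im) ∨
       (∀ μ ∈ spectrum ℂ (Matrix.of fun a b : Fin n2 =>
        (Qᴴ * A * Q) ⟨nzero + n1 + (a : ℕ), by have := a.isLt; omega⟩
          ⟨nzero + n1 + (b : ℕ), by have := b.isLt; omega⟩), μ.im < 0)) ∧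
      -- W (block (4,4)) is skew-Hermitian
      (Matrix.of fun a b : Fin n1 =>
        (Qᴴ * A * Q) ⟨nzero + n1 + n2 + (a : ℕ), by have := a.isLt; omega⟩
          ⟨nzero + n1 + n2 + (b : ℕ), by have := b.isLt; omega⟩)ᴴ =
      -(Matrix.of fun a b : Fin n1 =>
        (Qᴴ * A * Q) ⟨nzero + n1 + n2 + (a : ℕ), by have := a.isLt; omega⟩
          ⟨nzero + n1 + n2 + (b : ℕ), by have := b.isLt; omega⟩) := by
  classical
  have hpol : ∃ ε : ℝ, (ε = 1 ∨ ε = -1) ∧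
      (Finset.univ.filter fun i => 0 < ε * hH.eigenvalues i).card = n1 + n2 ∧
      (Finset.univ.filter fun i => ε * hH.eigenvalues i < 0).card = n1 := by
    rcases le_total npos nneg with h | h
    · refine ⟨1, Or.inl rfl, ?_, ?_⟩
      · simp only [one_mul]; rw [hneg]; omega
      · simp only [one_mul]; rw [hpos]; omega
    · refine ⟨-1, Or.inr rfl, ?_, ?_⟩
      · simp only [neg_one_mul, Left.neg_pos_iff]; rw [hpos]; omega
      · simp only [neg_one_mul, Left.neg_neg_iff]; rw [hneg]; omega
  obtain ⟨ε, hε, hc1, hc2⟩ := hpol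
  have hε0 : ε ≠ 0 := by rcases hε with h | h <;> rw [h] <;> norm_num
  have hn : n = nzero + n1 + n2 + n1 := by omega
  obtain ⟨e, he0, hep, hem⟩ := reorder (by omega) hH.eigenvalues ε hε0 hzero hc1 hc2
  obtain ⟨R, hR, r1, r2, r3, r4, r5, r6⟩ := core hn (fun i => hH.eigenvalues (e i)) ε he0
    (fun i h1 h2 => hep i h1 (by omega)) (fun i h => hem i (by omega))
  obtain ⟨Q, hQ, hM⟩ := assemble A hH e R hR
  have hskew : ∀ i j, star ((Qᴴ * A * Q) j i) = -(Qᴴ * A * Q) i j := by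
    intro i j
    have : (Qᴴ * A * Q)ᴴ = -(Qᴴ * A * Q) := by
      simp [conjTranspose_mul, hA, Matrix.mul_assoc]
    exact congrFun (congrFun this i) j
  refine ⟨Q, hQ, ?_⟩
  generalize Qᴴ * A * Q = M at hM hskew ⊢
  generalize Rᵀ * diagonal (fun i => hH.eigenvalues (e i)) * R = N at *
  have hzM : ∀ i j, N i j = 0 → M i j = 0 := by
    intro i j h; rw [hM, h]; simp
  have r4' : ∀ a b : Fin n2, a ≠ b →
      M ⟨nzero + n1 + (a : ℕ), by have := a.isLt; omega⟩
        ⟨nzero + n1 + (b : ℕ), by have := b.isLt; omega⟩ = 0 := by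
    intro a b hab
    refine hzM _ _ (r4 _ _ ?_ (by simp) (by simp))
    intro h
    exact hab (Fin.ext (by simpa using h))
  have hX : (Matrix.of fun a b : Fin n2 =>
        M ⟨nzero + n1 + (a : ℕ), by have := a.isLt; omega⟩
          ⟨nzero + n1 + (b : ℕ), by have := b.isLt; omega⟩) =
      diagonal fun a : Fin n2 => M ⟨nzero + n1 + (a : ℕ), by have := a.isLt; omega⟩
          ⟨nzero + n1 + (a : ℕ), by have := a.isLt; omega⟩ := by
    ext a b
    rw [diagonal_apply, of_apply]
    split_ifs with h
    · rw [h]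
    · exact r4' a b h
  refine ⟨?_, ?_, ?_, ?_, ?_, ?_, ?_, ?_⟩
  · intro i j h; exact hzM _ _ (r1 i j h)
  · intro i j h1 h2 h3 h4
    apply hzM
    by_cases h : i = j
    · rw [← h]; exact r3 i h1 h2
    · exact r2 i j h (by omega)
  · intro i j h1 h2 h3 h4
    exact hzM _ _ (r4 i j (fun h => by rw [h] at h1; omega) h1 h2)
  · intro a b hab
    refine hzM _ _ (r2 _ _ ?_ ?_)
    · intro h
      have h7 := congrArg Fin.val h
      have := b.isLt
      dsimp only at h7; omega
    · simp; omega
  · set Y : Matrix (Fin n1) (Fin n1) ℂ := Matrix.of fun a b : Fin n1 =>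
        M ⟨nzero + n1 + n2 + (a : ℕ), by have := a.isLt; omega⟩
          ⟨nzero + (b : ℕ), by have := b.isLt; omega⟩ with hY
    have hd : Y.submatrix id Fin.revPerm = diagonal fun a => Y a (Fin.rev a) := by
      ext a b
      rw [diagonal_apply, submatrix_apply, Fin.revPerm_apply, id]
      split_ifs with h
      · rw [h]
      · refine hzM _ _ (r2 _ _ ?_ ?_)
        · intro h
          have h7 := congrArg Fin.val h
          have := (Fin.rev b).isLt
          dsimp only at h7; omega
        · have h' : (a : ℕ) ≠ b := fun hh => h (Fin.ext hh)
          have := a.isLt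
          have := b.isLt
          simp only [Fin.val_rev]; omega
    have h1 := det_permute' Fin.revPerm Y
    rw [hd, det_diagonal] at h1
    rw [isUnit_iff_ne_zero]
    intro h
    rw [h, mul_zero, Finset.prod_eq_zero_iff] at h1
    obtain ⟨a, -, ha⟩ := h1
    rw [hY, of_apply, hM] at ha
    have := a.isLt
    refine r6 ⟨nzero + n1 + n2 + (a : ℕ), by omega⟩
      ⟨nzero + ((Fin.rev a : Fin n1) : ℕ), by have := (Fin.rev a).isLt; omega⟩ (by simp)
      (by simp only [Fin.val_rev]; omega) ?_
    simpa using ha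
  · ext a b; exact hskew _ _
  · have him : ∀ a : Fin n2, (M ⟨nzero + n1 + (a : ℕ), by have := a.isLt; omega⟩
          ⟨nzero + n1 + (a : ℕ), by have := a.isLt; omega⟩).im =
        - N ⟨nzero + n1 + (a : ℕ), by have := a.isLt; omega⟩
          ⟨nzero + n1 + (a : ℕ), by have := a.isLt; omega⟩ := by
      intro a; rw [hM]; simp
    have h5 := fun a : Fin n2 => r5 ⟨nzero + n1 + (a : ℕ), by have := a.isLt; omega⟩
      (by simp) (by simp)
    rw [hX, spectrum_diagonal]
    rcases hε with rfl | rfl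
    · right
      rintro _ ⟨a, rfl⟩
      have := h5 a
      rw [him]; linarith
    · left
      rintro _ ⟨a, rfl⟩
      have := h5 a
      rw [him]; linarith
  · ext a b; exact hskew _ _
end
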